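/- Let A be a finite set and C, D total clones on A with D ⊆ C such that for some a ∈ A the constant functions c_a with value a belong to C but not to D. Then |I_str(D)| ≥ |I_str(C)|. -/

import Mathlib

namespace StrongPartial

/-- Partial functions of arity `n+1` on `A` (arities are `≥ 1`).
`f.2 x = some a` means `x ∈ dom f` with value `a`; `f.2 x = none` means `x ∉ dom f`. -/
def PF (A : Type) : Type := Σ n : ℕ, (Fin (n+1) → A) → Option A

variable {A : Type}

/-- `f` is a total function. -/
def IsTotalPF (f : PF A) : Prop := ∀ x, (f.2 x).isSome

/-- The set of all total functions on `A`. -/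
def OSet (A : Type) : Set (PF A) := {f | IsTotalPF f}

/-- The `(n+1)`-ary projection onto the `i`-th coordinate. -/
def proj (n : ℕ) (i : Fin (n+1)) : PF A := ⟨n, fun x => some (x i)⟩

/-- Composition of an arity-`k` partial function with `k` partial functions of arity `m`. -/
def compFun {k m : ℕ} (f : (Fin k → A) → Option A) (g : Fin k → ((Fin m → A) → Option A)) :
    (Fin m → A) → Option A :=
  fun x => if h : ∀ i, (g i x).isSome then f (fun i => (g i x).get (h i)) else none

/-- A partial clone: contains all projections and is closed under composition. -/
def IsPartialClone (X : Set (PF A)) : Prop :=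
  (∀ (n : ℕ) (i : Fin (n+1)), proj n i ∈ X) ∧
  (∀ f ∈ X, ∀ (m : ℕ) (g : Fin (f.1+1) → ((Fin (m+1) → A) → Option A)),
     (∀ i, (⟨m, g i⟩ : PF A) ∈ X) → (⟨m, compFun f.2 g⟩ : PF A) ∈ X)

/-- A total clone: a partial clone consisting of total functions. -/
def IsClone (C : Set (PF A)) : Prop := IsPartialClone C ∧ C ⊆ OSet A

/-- `f ≤ g`: `f` is a restriction (subfunction) of `g`. -/
def PFle (f g : PF A) : Prop :=
  ∃ h : f.1 = g.1, ∀ (x : Fin (f.1+1) → A) (a : A),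
    f.2 x = some a → g.2 (fun i => x (Fin.cast (by rw [h]) i)) = some a

/-- `Str X`: all restrictions of members of `X`. -/
def StrSet (X : Set (PF A)) : Set (PF A) := {f | ∃ g ∈ X, PFle f g}

/-- `X` is strong (restriction closed). -/
def IsStrong (X : Set (PF A)) : Prop := StrSet X = X

/-- `f` preserves the `h`-ary relation `ρ`. -/
def Preserves (f : PF A) {h : ℕ} (ρ : Set (Fin h → A)) : Prop :=
  ∀ (M : Fin h → Fin (f.1+1) → A) (v : Fin h → A),
    (∀ j, (fun i => M i j) ∈ ρ) → (∀ i, f.2 (M i) = some (v i)) → v ∈ ρ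

def pPolSet {h : ℕ} (ρ : Set (Fin h → A)) : Set (PF A) := {f | Preserves f ρ}

def PolSet {h : ℕ} (ρ : Set (Fin h → A)) : Set (PF A) := pPolSet ρ ∩ OSet A

/-- `f` preserves the relation pair `(ρ, ρ')`. -/
def PreservesPair (f : PF A) {h : ℕ} (ρ ρ' : Set (Fin h → A)) : Prop :=
  ∀ (M : Fin h → Fin (f.1+1) → A) (v : Fin h → A),
    (∀ j, (fun i => M i j) ∈ ρ) → (∀ i, f.2 (M i) = some (v i)) → v ∈ ρ'

def cPolSet {h : ℕ} (ρ ρ' : Set (Fin h → A)) : Set (PF A) := {f | PreservesPair f ρ ρ'}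

/-- The interval `I_str(C)` of strong partial clones with total part `C`. -/
def Istr (C : Set (PF A)) : Set (Set (PF A)) :=
  {X | IsPartialClone X ∧ IsStrong X ∧ X ∩ OSet A = C}

/-! Maltsev operations -/

def zeta (f : PF A) : PF A := ⟨f.1, fun x => f.2 (fun i => x (i + 1))⟩

def tau (f : PF A) : PF A := ⟨f.1, fun x => f.2 (fun i => x (Equiv.swap 0 1 i))⟩

def nabla (f : PF A) : PF A := ⟨f.1 + 1, fun x => f.2 (fun i => x i.succ)⟩

def delta (f : PF A) : PF A :=
  match f with
  | ⟨0, g⟩ => ⟨0, g⟩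
  | ⟨n+1, g⟩ => ⟨n, fun x => g (fun i => x ⟨i.val - 1, by have := i.isLt; omega⟩)⟩

/-- `f ⋆ g`. -/
def starPF (f g : PF A) : PF A :=
  ⟨f.1 + g.1, fun x =>
    (g.2 (fun j => x ⟨j.val, by have := j.isLt; omega⟩)).bind
      (fun a => f.2 (fun i =>
        if i.val = 0 then a else x ⟨g.1 + i.val, by have := i.isLt; omega⟩))⟩

/-- A partial class: closed under `ζ`, `τ`, `Δ`, `∇` and `⋆`. -/
def IsPartialClass (X : Set (PF A)) : Prop :=
  (∀ f ∈ X, zeta f ∈ X) ∧ (∀ f ∈ X, tau f ∈ X) ∧ (∀ f ∈ X, delta f ∈ X) ∧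
  (∀ f ∈ X, nabla f ∈ X) ∧ (∀ f ∈ X, ∀ g ∈ X, starPF f g ∈ X)

def starSet (X Y : Set (PF A)) : Set (PF A) := {h | ∃ f ∈ X, ∃ g ∈ Y, h = starPF f g}

/-- The constant function of arity `n+1` with value `a`. -/
def constPF (a : A) (n : ℕ) : PF A := ⟨n, fun _ => some a⟩

/-- The total clone generated by a set `G` of total functions. -/
def cloneGen (G : Set (PF A)) : Set (PF A) := ⋂₀ {C | IsClone C ∧ G ⊆ C}



theorem compFun_some {k m : ℕ} (f : (Fin k → A) → Option A)
    (g : Fin k → ((Fin m → A) → Option A)) (x : Fin m → A) (b : A) :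
    compFun f g x = some b ↔ ∃ v : Fin k → A, (∀ i, g i x = some (v i)) ∧ f v = some b := by
  unfold compFun
  constructor
  · intro h
    split_ifs at h with h1
    exact ⟨_, fun i => by simp, h⟩
  · rintro ⟨v, hv, hf⟩
    have h1 : ∀ i, (g i x).isSome := fun i => by simp [hv i]
    rw [dif_pos h1]
    have : (fun i => (g i x).get (h1 i)) = v := by
      funext i
      simp [hv i]
    rw [this, hf]

theorem compFun_proj {n : ℕ} (f : (Fin n → A) → Option A) :
    compFun f (fun i x => some (x i)) = f := by
  funext x
  simp [compFun]

open Classical in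
/-- `f` guarded by an extra last argument equal to `a`. -/
noncomputable def guarded (a : A) {n : ℕ} (f : (Fin (n+1) → A) → Option A) :
    (Fin (n+1+1) → A) → Option A :=
  fun x => if x (Fin.last _) = a then f (fun i => x i.castSucc) else none

theorem guarded_some (a : A) {n : ℕ} (f : (Fin (n+1) → A) → Option A) (x) (b : A) :
    guarded a f x = some b ↔ x (Fin.last _) = a ∧ f (fun i => x i.castSucc) = some b := by
  unfold guarded
  split_ifs with h <;> simp [h]

theorem strong_mem {X : Set (PF A)} (hX : IsStrong X) {n : ℕ}
    {f g : (Fin (n+1) → A) → Option A} (hg : (⟨n, g⟩ : PF A) ∈ X)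
    (h : ∀ x b, f x = some b → g x = some b) : (⟨n, f⟩ : PF A) ∈ X := by
  rw [← hX]
  exact ⟨_, hg, rfl, h⟩

inductive Gen (a : A) (D X : Set (PF A)) : (m : ℕ) → ((Fin (m+1) → A) → Option A) → Prop
  | pr (n : ℕ) (i : Fin (n+1)) : Gen a D X n (fun x => some (x i))
  | restr (n : ℕ) (f g : (Fin (n+1) → A) → Option A) (hg : Gen a D X n g)
      (h : ∀ x b, f x = some b → g x = some b) : Gen a D X n f
  | compD (k m : ℕ) (d : (Fin (k+1) → A) → Option A) (hd : (⟨k, d⟩ : PF A) ∈ D)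
      (g : Fin (k+1) → (Fin (m+1) → A) → Option A) (hg : ∀ i, Gen a D X m (g i)) :
      Gen a D X m (compFun d g)
  | compX (k m : ℕ) (f : (Fin (k+1) → A) → Option A) (hf : (⟨k, f⟩ : PF A) ∈ X)
      (g : Fin (k+1+1) → (Fin (m+1) → A) → Option A) (hg : ∀ i, Gen a D X m (g i)) :
      Gen a D X m (compFun (guarded a f) g)

theorem compFun_assoc {k l m : ℕ} (f : (Fin k → A) → Option A)
    (g : Fin k → (Fin l → A) → Option A) (h : Fin l → (Fin m → A) → Option A)
    (x : Fin m → A) (b : A) (hb : compFun (compFun f g) h x = some b) :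
    compFun f (fun i => compFun (g i) h) x = some b := by
  obtain ⟨v, hv, hf⟩ := (compFun_some _ _ _ _).1 hb
  obtain ⟨w, hw, hf⟩ := (compFun_some _ _ _ _).1 hf
  exact (compFun_some _ _ _ _).2 ⟨w, fun i => (compFun_some _ _ _ _).2 ⟨v, hv, hw i⟩, hf⟩

theorem Gen.comp {a : A} {D X : Set (PF A)} {k : ℕ} {f : (Fin (k+1) → A) → Option A}
    (hf : Gen a D X k f) (m : ℕ) (h : Fin (k+1) → (Fin (m+1) → A) → Option A)
    (hh : ∀ i, Gen a D X m (h i)) : Gen a D X m (compFun f h) := by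
  induction hf with
  | pr n i =>
    refine .restr _ _ _ (hh i) fun x b hb => ?_
    obtain ⟨v, hv, hf⟩ := (compFun_some _ _ _ _).1 hb
    rw [hv i, hf]
  | restr n f g hg hle ih =>
    refine .restr _ _ _ (ih h hh) fun x b hb => ?_
    obtain ⟨v, hv, hf⟩ := (compFun_some _ _ _ _).1 hb
    exact (compFun_some _ _ _ _).2 ⟨v, hv, hle _ _ hf⟩
  | compD k l d hd g hg ih =>
    exact .restr _ _ _ (.compD _ _ d hd _ fun i => ih i h hh) (compFun_assoc _ _ _)
  | compX k l d hd g hg ih =>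
    exact .restr _ _ _ (.compX _ _ d hd _ fun i => ih i h hh) (compFun_assoc _ _ _)

theorem Gen.total {a : A} {D X : Set (PF A)} (hD : IsClone D) (hDa : ∀ n : ℕ, constPF a n ∉ D)
    {m : ℕ} {f : (Fin (m+1) → A) → Option A}
    (hf : Gen a D X m f) (ht : ∀ x, ∃ b, f x = some b) : (⟨m, f⟩ : PF A) ∈ D := by
  induction hf with
  | pr n i => exact hD.1.1 n i
  | restr n f g hg hle ih =>
    have : f = g := by
      funext x
      obtain ⟨b, hb⟩ := ht x
      rw [hb, hle _ _ hb]
    subst this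
    exact ih ht
  | compD k l d hd g hg ih =>
    refine hD.1.2 _ hd l g fun i => ih i fun x => ?_
    obtain ⟨b, hb⟩ := ht x
    obtain ⟨v, hv, -⟩ := (compFun_some _ _ _ _).1 hb
    exact ⟨_, hv i⟩
  | compX k l d hd g hg ih =>
    exfalso
    have key : ∀ x, g (Fin.last _) x = some a := fun x => by
      obtain ⟨b, hb⟩ := ht x
      obtain ⟨v, hv, hf⟩ := (compFun_some _ _ _ _).1 hb
      rw [hv, ((guarded_some _ _ _ _).1 hf).1]
    have h1 := ih (Fin.last _) fun x => ⟨a, key x⟩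
    have h2 : g (Fin.last _) = fun _ => some a := funext key
    rw [h2] at h1
    exact hDa l h1

theorem Gen.sub {a : A} {D X : Set (PF A)} (hX : IsPartialClone X) (hs : IsStrong X)
    (hDX : D ⊆ X) {m : ℕ} {f : (Fin (m+1) → A) → Option A}
    (hf : Gen a D X m f) : (⟨m, f⟩ : PF A) ∈ X := by
  induction hf with
  | pr n i => exact hX.1 n i
  | restr n f g hg hle ih => exact strong_mem hs ih hle
  | compD k l d hd g hg ih => exact hX.2 _ (hDX hd) l g ih
  | compX k l d hd g hg ih =>
    refine strong_mem hs (hX.2 _ hd l (fun i => g i.castSucc) fun i => ih _) fun x b hb => ?_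
    obtain ⟨v, hv, hf⟩ := (compFun_some _ _ _ _).1 hb
    exact (compFun_some _ _ _ _).2 ⟨_, fun i => hv _, ((guarded_some _ _ _ _).1 hf).2⟩

def GenSet (a : A) (D X : Set (PF A)) : Set (PF A) := {f | Gen a D X f.1 f.2}

theorem GenSet_mem {a : A} {D X : Set (PF A)} (hD : IsClone D)
    (hDa : ∀ n : ℕ, constPF a n ∉ D) : GenSet a D X ∈ Istr D := by
  refine ⟨⟨fun n i => Gen.pr n i, fun f hf m g hg => Gen.comp hf m g hg⟩, ?_, ?_⟩
  · apply Set.Subset.antisymm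
    · rintro ⟨n, f⟩ ⟨⟨n', g⟩, hg, h, hle⟩
      dsimp at h
      subst h
      exact Gen.restr _ _ _ hg hle
    · intro f hf
      exact ⟨f, hf, rfl, fun x b h => h⟩
  · apply Set.Subset.antisymm
    · rintro ⟨n, f⟩ ⟨hf, ht⟩
      exact Gen.total hD hDa hf fun x => Option.isSome_iff_exists.1 (ht x)
    · rintro ⟨n, f⟩ hf
      refine ⟨?_, hD.2 hf⟩
      have := Gen.compD (a := a) (D := D) (X := X) n n f hf _ (fun i => Gen.pr n i)
      rw [compFun_proj] at this
      exact this

theorem GenSet_le {a : A} {C D X Y : Set (PF A)} (hDC : D ⊆ C)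
    (hCa : ∀ n : ℕ, constPF a n ∈ C) (hY : Y ∈ Istr C)
    (h : GenSet a D X ⊆ GenSet a D Y) : X ⊆ Y := by
  rintro ⟨n, f⟩ hf
  obtain ⟨hc, hs, ht⟩ := hY
  have hCY : C ⊆ Y := by
    rw [← ht]
    exact Set.inter_subset_left
  have h1 : Gen a D X (n+1) (guarded a f) := by
    have := Gen.compX (a := a) (D := D) (X := X) n (n+1) f hf _ (fun i => Gen.pr (n+1) i)
    rwa [compFun_proj] at this
  have h2 : Gen a D Y (n+1) (guarded a f) := @h ⟨n+1, guarded a f⟩ h1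
  have h3 := Gen.sub hc hs (hDC.trans hCY) h2
  have h4 := hc.2 _ h3 n (Fin.lastCases (fun _ => some a) (fun i x => some (x i))) (fun i => by
    induction i using Fin.lastCases with
    | last => rw [Fin.lastCases_last]; exact hCY (hCa n)
    | cast i => rw [Fin.lastCases_castSucc]; exact hc.1 n i)
  refine strong_mem hs h4 fun x b hb => ?_
  refine (compFun_some _ _ _ _).2 ⟨Fin.lastCases a x, fun i => ?_, ?_⟩
  · induction i using Fin.lastCases with
    | last => simp
    | cast i => simp
  · exact (guarded_some _ _ _ _).2 ⟨by simp, by simpa using hb⟩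

theorem Istr_card_le_of_missing_constant {A : Type} [Fintype A] (C D : Set (PF A))
    (hC : IsClone C) (hD : IsClone D) (hDC : D ⊆ C) (a : A)
    (hCa : ∀ n : ℕ, constPF a n ∈ C) (hDa : ∀ n : ℕ, constPF a n ∉ D) :
    Cardinal.mk ↥(Istr C) ≤ Cardinal.mk ↥(Istr D) := by
  refine Cardinal.mk_le_of_injective
    (f := fun X : ↥(Istr C) => (⟨GenSet a D X.1, GenSet_mem hD hDa⟩ : ↥(Istr D))) ?_
  intro X Y h
  have h' : GenSet a D X.1 = GenSet a D Y.1 := congrArg Subtype.val h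
  exact Subtype.ext (Set.Subset.antisymm (GenSet_le hDC hCa Y.2 h'.le)
    (GenSet_le hDC hCa X.2 h'.ge))

end StrongPartial
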